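/- arXiv:2010.04961 — 3 statements merged into one kernel-verified Lean document; each statement's English description precedes it below -/
import Mathlib

section
/- In a structured semigroup (S, N, Z), if A ⊆ S satisfies AA^*A ⊆ A then: (i) A^{<*} = A^{*<} ⊆ A^*; and (ii) A^{<<} = A^{**}. -/
open Pointwise

variable {S : Type*}

/-- `a <_s b`: the domination relation via `s`. -/
def domBy [Semigroup S] (N Z : Set S) (a s b : S) : Prop :=
  a * s * b = a ∧ b * s * a = a ∧ a * s ∈ N ∧ s * a ∈ N ∧ b * s ∈ Z ∧ s * b ∈ Z

/-- `a < b`: domination. -/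
def domRel [Semigroup S] (N Z : Set S) (a b : S) : Prop := ∃ s, domBy N Z a s b

/-- The up-closure `A^<`. -/
def upClo [Semigroup S] (N Z : Set S) (A : Set S) : Set S :=
  {b | ∃ a ∈ A, domRel N Z a b}

/-- The dual `A^*`. -/
def dualSet [Semigroup S] (N Z : Set S) (A : Set S) : Set S :=
  {s | ∃ a ∈ A, ∃ b, domBy N Z a s b}

/-- Structured semigroup data on `(S, N, Z)`. -/
structure Structured [Semigroup S] (N Z : Set S) : Prop where
  nMul : ∀ m ∈ N, ∀ n ∈ N, m * n ∈ N
  zMul : ∀ y ∈ Z, ∀ z ∈ Z, y * z ∈ Z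
  zSubN : Z ⊆ N
  zComm : ∀ z ∈ Z, ∀ n ∈ N, z * n = n * z
  binormal : ∀ a b : S, a * b ∈ Z → b * a ∈ Z → ∀ z ∈ Z, a * z * b ∈ Z ∧ b * z * a ∈ Z
  trinormal : ∀ a b : S, ∀ n ∈ N, a * b * n = n → n * a * b = n →
    a * b ∈ Z → b * a ∈ Z → b * n * a ∈ N

/-- An atlas: `A A^* A ⊆ A ⊆ A^<`. -/
def IsAtlas [Semigroup S] (N Z : Set S) (A : Set S) : Prop :=
  A * dualSet N Z A * A ⊆ A ∧ A ⊆ upClo N Z A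

/-- A coset: `A A^* A ⊆ A = A^<`. -/
def IsCoset [Semigroup S] (N Z : Set S) (A : Set S) : Prop :=
  A * dualSet N Z A * A ⊆ A ∧ upClo N Z A = A

/-- Source `s(A) = (A^* A)^<`. -/
def srcSet [Semigroup S] (N Z : Set S) (A : Set S) : Set S :=
  upClo N Z (dualSet N Z A * A)

/-- Range `r(A) = (A A^*)^<`. -/
def rngSet [Semigroup S] (N Z : Set S) (A : Set S) : Set S :=
  upClo N Z (A * dualSet N Z A)

/-- `A|b`: `b` acts on `A` from the right. -/
def actsR [Semigroup S] (Z : Set S) (A : Set S) (b : S) : Prop :=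
  ∃ b', b * b' ∈ Z ∧ b' * b ∈ Z ∧ ∃ a ∈ A, a * b * b' = a

/-- `b|A`: `b` acts on `A` from the left. -/
def actsL [Semigroup S] (Z : Set S) (b : S) (A : Set S) : Prop :=
  ∃ b', b * b' ∈ Z ∧ b' * b ∈ Z ∧ ∃ a ∈ A, b' * b * a = a

/-- `A^Z = {z ∈ Z : az = a for some a ∈ A}`. -/
def AZset [Semigroup S] (Z : Set S) (A : Set S) : Set S :=
  {z ∈ Z | ∃ a ∈ A, a * z = a}

/-- `^Z A = {z ∈ Z : za = a for some a ∈ A}`. -/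
def ZAset [Semigroup S] (Z : Set S) (A : Set S) : Set S :=
  {z ∈ Z | ∃ a ∈ A, z * a = a}

/-- The equivalence relation `a ~_A b`. -/
def eqvA [Semigroup S] (N Z : Set S) (A : Set S) (a b : S) : Prop :=
  ∃ s ∈ dualSet N Z A, ∃ t ∈ dualSet N Z A, s * a * t = s * b * t

/-- `Y` is symmetric: `ab ∈ Y → baba ∈ Y`. -/
def IsSymmetric [Semigroup S] (Y : Set S) : Prop :=
  ∀ a b : S, a * b ∈ Y → b * a * b * a ∈ Y

/-- `D` is diagonal: `ad, d, db ∈ D → adb ∈ D`. -/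
def IsDiagonal [Semigroup S] (D : Set S) : Prop :=
  ∀ a d b : S, a * d ∈ D → d ∈ D → d * b ∈ D → a * d * b ∈ D

/-- Domination is transitive, keeping the second witness. -/
theorem domBy_trans [Semigroup S] {N Z : Set S} (h : Structured N Z) {a s b t c : S}
    (hab : domBy N Z a s b) (hbc : domBy N Z b t c) : domBy N Z a t c := by
  obtain ⟨h1, h2, h3, h4, h5, h6⟩ := hab
  obtain ⟨k1, k2, k3, k4, k5, k6⟩ := hbc
  refine ⟨?_, ?_, ?_, ?_, k5, k6⟩
  · grind
  · calc c * t * a = c * t * b * s * a := by simp only [mul_assoc]; rw [← mul_assoc b s a, h2]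
      _ = a := by rw [k2, h2]
  · have := h.nMul _ h3 _ k3
    grind
  · have := h.nMul _ k4 _ h4
    grind

/-- From `a <_s b <_t c`, the element `tbs` is a dual witness for `a` dominated by `t`. -/
theorem domBy_mul_mul [Semigroup S] {N Z : Set S} (h : Structured N Z) {a s b t c : S}
    (hab : domBy N Z a s b) (hbc : domBy N Z b t c) :
    domBy N Z a (t * b * s) c ∧ domBy N Z (t * b * s) c t := by
  have hac := domBy_trans h hab hbc
  obtain ⟨h1, h2, h3, h4, h5, h6⟩ := hab
  obtain ⟨k1, k2, k3, k4, k5, k6⟩ := hbc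
  obtain ⟨l1, l2, l3, l4, -, -⟩ := hac
  have e1 : a * (t * b * s) = a * t := by
    have := h.zComm _ h5 _ l3
    grind
  have e2 : t * b * s * a = t * a := by grind
  have e3 : c * (t * b * s) = b * s := by grind
  have z1 : t * b * s * c ∈ Z := by
    have := (h.binormal _ _ k6 k5 _ h5).1
    grind
  have e4 : t * b * s * c * t = t * b * s := by
    have := h.zComm _ h5 _ (h.zSubN k5)
    grind
  have e5 : t * c * (t * b * s) = t * b * s := by grind
  refine ⟨⟨?_, ?_, ?_, ?_, ?_, z1⟩, ⟨e4, e5, h.zSubN z1, ?_, k6, k5⟩⟩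
  · rw [e1, l1]
  · grind
  · rwa [e1]
  · rwa [e2]
  · rwa [e3]
  · rw [e3]; exact h.zSubN h5

/-- If `a <_s b` and `s <_c t`, then `scs` is also a dual witness for `a`, and
`ascsa <_t bsc <_t c`. -/
theorem domBy_of_domBy_dual [Semigroup S] {N Z : Set S} (h : Structured N Z) {a s b t c : S}
    (hab : domBy N Z a s b) (hst : domBy N Z s c t) :
    domBy N Z a (s * c * s) (b * t * b) ∧
      domBy N Z (a * (s * c * s) * a) t (b * s * c) ∧ domBy N Z (b * s * c) t c := by
  obtain ⟨h1, h2, h3, h4, h5, h6⟩ := hab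
  obtain ⟨k1, k2, k3, k4, k5, k6⟩ := hst
  have c1 : c * t * (a * s) = a * s := by
    have := h.zComm _ k6 _ h3
    grind
  have c1' : a * s * c * t = a * s := by grind
  have c2 : t * c * (s * a) = s * a := by grind
  have c2' : s * a * t * c = s * a := by
    have := h.zComm _ k5 _ h4
    grind
  have n1 : t * (a * s) * c ∈ N :=
    h.trinormal c t (a * s) h3 c1 c1' k6 k5
  have n2 : c * (s * a) * t ∈ N :=
    h.trinormal t c (s * a) h4 c2 c2' k5 k6
  have z1 : t * (b * s) * c ∈ Z := (h.binormal _ _ k5 k6 _ h5).1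
  have z2 : c * (s * b) * t ∈ Z := (h.binormal _ _ k6 k5 _ h6).1
  have m1 : s * b * (s * c) = s * c * (s * b) := h.zComm _ h6 _ k3
  have m2 : b * s * (c * s) = c * s * (b * s) := h.zComm _ h5 _ k4
  have m3 : b * s * (c * t) = c * t * (b * s) := h.zComm _ h5 _ (h.zSubN k6)
  have dt : b * s * c * t = b * s := by
    calc _ = b * (s * c * t) := by simp only [mul_assoc]
      _ = _ := by rw [k1]
  have p1 : a * (s * c * s) * a * t ∈ N := by
    have := h.nMul _ h3 _ n2
    simpa only [mul_assoc] using this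
  have p2 : t * (a * (s * c * s) * a) ∈ N := by
    have := h.nMul _ n1 _ h4
    simpa only [mul_assoc] using this
  have q1 : a * (s * c * s) * a * t * c = a * (s * c * s) * a := by
    calc _ = a * s * c * (s * a * t * c) := by simp only [mul_assoc]
      _ = _ := by rw [c2']; simp only [mul_assoc]
  have q2 : b * s * (a * (s * c * s) * a) = a * (s * c * s) * a := by
    calc _ = b * s * a * (s * c * s) * a := by simp only [mul_assoc]
      _ = _ := by rw [h2]
  refine ⟨⟨?_, ?_, ?_, ?_, ?_, ?_⟩, ⟨?_, ?_, p1, p2, ?_, ?_⟩, ⟨?_, ?_, ?_, ?_, k6, k5⟩⟩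
  · calc _ = a * (s * c * (s * b)) * t * b := by simp only [mul_assoc]
      _ = a * s * b * (s * c * t) * b := by rw [← m1]; simp only [mul_assoc]
      _ = a := by rw [h1, k1, h1]
  · calc _ = b * t * (b * s * (c * s)) * a := by simp only [mul_assoc]
      _ = b * (t * c * s) * (b * s * a) := by rw [m2]; simp only [mul_assoc]
      _ = a := by rw [k2, h2, h2]
  · have := h.nMul _ h3 _ k4
    simpa only [mul_assoc] using this
  · have := h.nMul _ k3 _ h4
    simpa only [mul_assoc] using this
  · have := (h.binormal _ _ h5 h6 _ z1).1
    simpa only [mul_assoc] using this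
  · have := (h.binormal _ _ h6 h5 _ z2).1
    simpa only [mul_assoc] using this
  · calc _ = a * (s * c * s) * a * t * (b * s) * c := by simp only [mul_assoc]
      _ = b * s * (a * (s * c * s) * a * t) * c := by rw [h.zComm _ h5 _ p1]
      _ = b * s * (a * (s * c * s) * a) * t * c := by simp only [mul_assoc]
      _ = _ := by rw [q2, q1]
  · rw [dt, q2]
  · rwa [dt]
  · simpa only [mul_assoc] using z1
  · grind
  · calc _ = c * t * (b * s) * c := by simp only [mul_assoc]
      _ = b * (s * c * t) * c := by rw [← m3]; simp only [mul_assoc]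
      _ = _ := by rw [k1]
  · rw [dt]; exact h.zSubN h5
  · have := h.zSubN z1
    simpa only [mul_assoc] using this

theorem stmt9 [Semigroup S] (N Z : Set S) (h : Structured N Z) (A : Set S)
    (hA : A * dualSet N Z A * A ⊆ A) :
    dualSet N Z (upClo N Z A) = upClo N Z (dualSet N Z A) ∧
    upClo N Z (dualSet N Z A) ⊆ dualSet N Z A ∧
    upClo N Z (upClo N Z A) = dualSet N Z (dualSet N Z A) := by
  have key : ∀ a ∈ A, ∀ s b t c, domBy N Z a s b → domBy N Z s c t →
      ∃ d ∈ upClo N Z A, domBy N Z d t c := by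
    intro a ha s b t c hab hst
    obtain ⟨hu, hd, hc⟩ := domBy_of_domBy_dual h hab hst
    exact ⟨_, ⟨_, hA (Set.mul_mem_mul (Set.mul_mem_mul ha ⟨a, ha, _, hu⟩) ha), t, hd⟩, hc⟩
  have hstar : dualSet N Z (upClo N Z A) = upClo N Z (dualSet N Z A) := by
    ext t
    constructor
    · rintro ⟨b, ⟨a, ha, s, hab⟩, c, hbc⟩
      obtain ⟨h1, h2⟩ := domBy_mul_mul h hab hbc
      exact ⟨_, ⟨a, ha, c, h1⟩, c, h2⟩
    · rintro ⟨s, ⟨a, ha, b, hab⟩, c, hst⟩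
      obtain ⟨d, hd, hdc⟩ := key a ha s b t c hab hst
      exact ⟨d, hd, c, hdc⟩
  refine ⟨hstar, ?_, ?_⟩
  · rw [← hstar]
    rintro t ⟨b, ⟨a, ha, s, hab⟩, c, hbc⟩
    exact ⟨a, ha, c, domBy_trans h hab hbc⟩
  · ext c
    constructor
    · rintro ⟨b, ⟨a, ha, s, hab⟩, t, hbc⟩
      obtain ⟨h1, h2⟩ := domBy_mul_mul h hab hbc
      exact ⟨_, ⟨a, ha, c, h1⟩, t, h2⟩
    · rintro ⟨s, ⟨a, ha, b, hab⟩, t, hst⟩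
      obtain ⟨d, hd, hdc⟩ := key a ha s b t c hab hst
      exact ⟨d, hd, t, hdc⟩
end

section
/- In a structured semigroup (S, N, Z), if A, B ⊆ S are atlases satisfying A^*A ⊆ (BB^*)^<, then the product AB is an atlas (so (AB)^* is a coset), and for every a ∈ A one has a|B (i.e. {a}|B holds) and ({a}B)^* = (AB)^*. -/
open Pointwise

variable {S : Type*}

section Domination

variable [Semigroup S] {N Z A B : Set S}

/-- Domination `p <_s P` together with central elements acting as units on `p` and
absorbing the units `s * P` and `P * s`. -/
structure StrongDomBy (N Z : Set S) (p s P : S) : Prop where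
  dom : domBy N Z p s P
  right : ∃ z ∈ Z, p * z = p ∧ z * (s * P) = z
  left : ∃ z ∈ Z, z * p = p ∧ P * s * z = z

namespace Structured

lemma domBy_trans (h : Structured N Z) {a b c s t : S}
    (h₁ : domBy N Z a s b) (h₂ : domBy N Z b t c) : domBy N Z a t c := by
  obtain ⟨a1, a2, a3, a4, a5, a6⟩ := h₁
  obtain ⟨b1, b2, b3, b4, b5, b6⟩ := h₂
  refine ⟨by grind, by rw [← a2, ← mul_assoc, ← mul_assoc, b2], ?_, ?_, b5, b6⟩
  · have : a * t = (a * s) * (b * t) := by grind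
    exact this ▸ h.nMul _ a3 _ b3
  · have : t * a = (t * b) * (s * a) := by grind
    exact this ▸ h.nMul _ b4 _ a4

lemma strongDomBy_trans (h : Structured N Z) {a b c s t : S}
    (h₁ : domBy N Z a s b) (h₂ : domBy N Z b t c) : StrongDomBy N Z a t c := by
  refine ⟨h.domBy_trans h₁ h₂, ?_, ?_⟩
  · exact ⟨s * b, h₁.2.2.2.2.2, by grind [domBy], by grind [domBy]⟩
  · exact ⟨b * s, h₁.2.2.2.2.1, by grind [domBy], by grind [domBy]⟩

/-- Conjugation by a strongly dominated pair preserves `N`. -/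
lemma mul_mul_mem (h : Structured N Z) {p s P : S} (hp : StrongDomBy N Z p s P)
    {n : S} (hn : n ∈ N) : p * n * s ∈ N ∧ s * n * p ∈ N := by
  obtain ⟨⟨a1, a2, a3, a4, a5, a6⟩, ⟨z, hz, z1, z2⟩, ⟨y, hy, y1, y2⟩⟩ := hp
  constructor
  · have c1 := h.zComm _ a6 _ (h.nMul _ (h.zSubN hz) _ hn)
    have c2 := h.zComm _ a6 _ (h.zSubN hz)
    have e : s * P * (z * n) = z * n := by rw [← mul_assoc, c2, z2]
    have key := h.trinormal s P (z * n) (h.nMul _ (h.zSubN hz) _ hn)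
      e (by rw [mul_assoc _ s, ← c1, e]) a6 a5
    have : p * n * s = (p * s) * (P * (z * n) * s) := by
      calc p * n * s = p * z * n * s := by rw [z1]
        _ = p * s * P * z * n * s := by rw [a1]
        _ = _ := by simp only [mul_assoc]
    exact this ▸ h.nMul _ a3 _ key
  · have c1 := h.zComm _ a5 _ (h.nMul _ hn _ (h.zSubN hy))
    have c2 := h.zComm _ a5 _ (h.zSubN hy)
    have e : n * y * (P * s) = n * y := by rw [mul_assoc, ← c2, y2]
    have key := h.trinormal P s (n * y) (h.nMul _ hn _ (h.zSubN hy))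
      (by rw [c1, e]) (by rw [mul_assoc _ P, e]) a5 a6
    have : s * n * p = (s * (n * y) * P) * (s * p) := by
      calc s * n * p = s * n * (y * (P * s * p)) := by rw [a2, y1]
        _ = _ := by simp only [mul_assoc]
    exact this ▸ h.nMul _ key _ a4

lemma strongDomBy_mul (h : Structured N Z) {p s P q t Q : S} (hp : StrongDomBy N Z p s P)
    (hq : StrongDomBy N Z q t Q) : StrongDomBy N Z (p * q) (t * s) (P * Q) := by
  have m1 := (h.mul_mul_mem hp hq.dom.2.2.1).1
  have m2 := (h.mul_mul_mem hq hp.dom.2.2.2.1).2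
  obtain ⟨⟨a1, a2, a3, a4, a5, a6⟩, ⟨z, hz, z1, z2⟩, ⟨y, hy, y1, y2⟩⟩ := hp
  obtain ⟨⟨b1, b2, b3, b4, b5, b6⟩, ⟨w, hw, w1, w2⟩, ⟨x, hx, x1, x2⟩⟩ := hq
  have k1 := (h.binormal P s a5 a6 _ b5).1
  have k2 := (h.binormal Q t b5 b6 _ a6).2
  have e1 := h.zComm _ a6 _ b3
  have e2 := h.zComm _ b5 _ a4
  refine ⟨⟨?_, ?_, by simpa only [mul_assoc] using m1, by simpa only [mul_assoc] using m2,
    by simpa only [mul_assoc] using k1, by simpa only [mul_assoc] using k2⟩, ?_, ?_⟩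
  · calc p * q * (t * s) * (P * Q) = p * (q * t * (s * P)) * Q := by simp only [mul_assoc]
      _ = (p * s * P) * (q * t * Q) := by rw [← e1]; simp only [mul_assoc]
      _ = p * q := by rw [a1, b1]
  · calc P * Q * (t * s) * (p * q) = P * (Q * t * (s * p)) * q := by simp only [mul_assoc]
      _ = (P * s * p) * (Q * t * q) := by rw [e2]; simp only [mul_assoc]
      _ = p * q := by rw [a2, b2]
  · refine ⟨t * z * Q * w, h.zMul _ (h.binormal Q t b5 b6 _ hz).2 _ hw, ?_, ?_⟩
    · have := h.zComm _ hz _ b3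
      calc p * q * (t * z * Q * w) = p * (q * t * z) * Q * w := by simp only [mul_assoc]
        _ = p * z * (q * t * Q) * w := by rw [← this]; simp only [mul_assoc]
        _ = p * (q * w) := by rw [z1, b1, mul_assoc]
        _ = p * q := by rw [w1]
    · have f1 := h.zComm _ hw _ (h.zSubN k2)
      have f2 := h.zComm _ b5 _ (h.zSubN a6)
      have f3 := h.zComm _ hw _ (h.zSubN b6)
      calc t * z * Q * w * (t * s * (P * Q))
          = t * z * Q * (w * (t * (s * P) * Q)) := by simp only [mul_assoc]
        _ = t * z * (Q * t * (s * P)) * Q * w := by rw [f1]; simp only [mul_assoc]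
        _ = t * (z * (s * P)) * Q * (t * Q * w) := by rw [f2]; simp only [mul_assoc]
        _ = t * z * Q * w := by rw [z2, ← f3, w2]
  · refine ⟨y * (P * x * s), h.zMul _ hy _ (h.binormal P s a5 a6 _ hx).1, ?_, ?_⟩
    · have := h.zComm _ hx _ a4
      calc y * (P * x * s) * (p * q) = y * (P * (x * (s * p)) * q) := by simp only [mul_assoc]
        _ = y * ((P * s * p) * (x * q)) := by rw [this]; simp only [mul_assoc]
        _ = p * q := by rw [a2, x1, ← mul_assoc, y1]
    · have f1 := h.zComm _ hy _ (h.zSubN k1)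
      have f2 := h.zComm _ b5 _ (h.zSubN a6)
      have f3 := h.zComm _ hy _ (h.zSubN a5)
      calc P * Q * (t * s) * (y * (P * x * s))
          = P * (Q * t) * s * y * (P * x * s) := by simp only [mul_assoc]
        _ = y * P * (Q * t * (s * P)) * x * s := by rw [← f1]; simp only [mul_assoc]
        _ = (y * (P * s)) * P * (Q * t * x) * s := by rw [f2]; simp only [mul_assoc]
        _ = y * (P * x * s) := by rw [f3, y2, x2]; simp only [mul_assoc]

/-- Multiples of `p` from both sides by elements of `N` are dominated when `p` is. -/
lemma domBy_of_eq_mul (h : Structured N Z) {p s c y m m' : S} (hp : domBy N Z p s c)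
    (hm : m ∈ N) (hm' : m' ∈ N) (h₁ : y = p * m) (h₂ : y = m' * p) : domBy N Z y s c := by
  obtain ⟨a1, a2, a3, a4, a5, a6⟩ := hp
  refine ⟨?_, ?_, ?_, ?_, a5, a6⟩
  · rw [h₂, mul_assoc m', mul_assoc m', a1]
  · rw [h₁, ← mul_assoc, a2]
  · rw [h₂, mul_assoc]; exact h.nMul _ hm' _ a3
  · rw [h₁, ← mul_assoc]; exact h.nMul _ a4 _ hm

lemma domBy_mul_mul (h : Structured N Z) {a q a₁ b v b₁ s c n : S}
    (ha : StrongDomBy N Z a q a₁) (hb : StrongDomBy N Z b v b₁) (hn : n ∈ N)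
    (hs : domBy N Z (a₁ * b₁) s c) : domBy N Z (a * n * b) s c := by
  have hqan := h.nMul _ ha.dom.2.2.2.1 _ hn
  have hnbv := h.nMul _ hn _ hb.dom.2.2.1
  refine h.domBy_of_eq_mul hs (h.mul_mul_mem hb hqan).2 (h.mul_mul_mem ha hnbv).1 ?_ ?_
  · have e := h.zComm _ hb.dom.2.2.2.2.1 _ hqan
    calc a * n * b = (a₁ * q * a) * n * (b₁ * v * b) := by rw [ha.dom.2.1, hb.dom.2.1]
      _ = a₁ * (q * a * n * (b₁ * v)) * b := by simp only [mul_assoc]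
      _ = _ := by rw [← e]; simp only [mul_assoc]
  · have e := h.zComm _ ha.dom.2.2.2.2.2 _ hnbv
    calc a * n * b = (a * q * a₁) * n * (b * v * b₁) := by rw [ha.dom.1, hb.dom.1]
      _ = a * (q * a₁ * (n * (b * v))) * b₁ := by simp only [mul_assoc]
      _ = _ := by rw [e]; simp only [mul_assoc]

lemma domBy_smul (h : Structured N Z) {p s c a r : S} (hp : domBy N Z p s c)
    (h₁ : a * r ∈ Z) : domBy N Z (a * r * p) s c := by
  obtain ⟨a1, a2, a3, a4, a5, a6⟩ := hp
  have k := (h.binormal c s a5 a6 _ h₁).2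
  have e := h.zComm _ a5 _ (h.zSubN h₁)
  refine ⟨by rw [mul_assoc, mul_assoc, ← mul_assoc p, a1], ?_, ?_, ?_, a5, a6⟩
  · rw [← mul_assoc, e, mul_assoc, a2]
  · rw [mul_assoc]; exact h.nMul _ (h.zSubN h₁) _ a3
  · have : s * (a * r * p) = (s * (a * r) * c) * (s * p) := by
      calc s * (a * r * p) = s * (a * r * (c * s * p)) := by rw [a2]
        _ = _ := by simp only [mul_assoc]
    exact this ▸ h.nMul _ (h.zSubN k) _ a4

lemma exists_strongDomBy (h : Structured N Z) (hA : A ⊆ upClo N Z A) {a : S} (ha : a ∈ A) :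
    ∃ a' ∈ A, ∃ s, StrongDomBy N Z a' s a := by
  obtain ⟨b, hb, s, hs⟩ := hA ha
  obtain ⟨c, hc, t, ht⟩ := hA hb
  exact ⟨c, hc, s, h.strongDomBy_trans ht hs⟩

lemma exists_strongDomBy_of_mem_dualSet (h : Structured N Z) (hA : A ⊆ upClo N Z A) {s : S}
    (hs : s ∈ dualSet N Z A) : ∃ a ∈ A, ∃ b, StrongDomBy N Z a s b := by
  obtain ⟨a, ha, b, hs⟩ := hs
  obtain ⟨c, hc, t, ht⟩ := hA ha
  exact ⟨c, hc, b, h.strongDomBy_trans ht hs⟩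

/-- Domination of `a` by `b` via `s` can be reversed to domination of `s * a * s` by `s`. -/
lemma domBy_dual {a s b : S} (hs : domBy N Z a s b) :
    domBy N Z (s * a * s) b s := by
  obtain ⟨a1, a2, a3, a4, a5, a6⟩ := hs
  refine ⟨by grind, by grind, ?_, ?_, a6, a5⟩
  · rwa [show s * a * s * b = s * (a * s * b) by simp only [mul_assoc], a1]
  · rwa [show b * (s * a * s) = b * s * a * s by simp only [mul_assoc], a2]

lemma exists_strongDomBy_dual (h : Structured N Z) (hA : A ⊆ upClo N Z A) {a : S}
    (ha : a ∈ A) : ∃ r ∈ dualSet N Z A, ∃ a' ∈ A, StrongDomBy N Z (r * a' * r) a r := by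
  obtain ⟨b, hb, r, hr⟩ := hA ha
  obtain ⟨c, hc, q, hq⟩ := hA hb
  have hcr := h.domBy_trans hq hr
  refine ⟨r, ⟨b, hb, a, hr⟩, c, hc, domBy_dual hcr, ?_, ?_⟩
  all_goals
    obtain ⟨a1, a2, a3, a4, a5, a6⟩ := hcr
    obtain ⟨b1, b2, b3, b4, b5, b6⟩ := hq
    obtain ⟨c1, c2, c3, c4, c5, c6⟩ := hr
  · have e1 := h.zComm _ b5 _ a3
    have e2 := h.zComm _ b5 _ (h.zSubN c5)
    exact ⟨b * q, b5, by grind, by grind⟩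
  · have e1 := h.zComm _ b6 _ a4
    have e2 := h.zComm _ b6 _ (h.zSubN c6)
    exact ⟨q * b, b6, by grind, by grind⟩

end Structured

lemma IsAtlas.mul_mul_mem (hA : IsAtlas N Z A) {a s b : S} (ha : a ∈ A)
    (hs : s ∈ dualSet N Z A) (hb : b ∈ A) : a * s * b ∈ A :=
  hA.1 (Set.mul_mem_mul (Set.mul_mem_mul ha hs) hb)

lemma IsAtlas.dualSet_mul_mul_mem (h : Structured N Z) (hA : IsAtlas N Z A) {a s t : S}
    (hs : s ∈ dualSet N Z A) (ha : a ∈ A) (ht : t ∈ dualSet N Z A) :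
    s * a * t ∈ dualSet N Z A := by
  obtain ⟨p, hp, P, hpP⟩ := h.exists_strongDomBy_of_mem_dualSet hA.2 hs
  obtain ⟨q, hq, Q, hqQ⟩ := h.exists_strongDomBy_of_mem_dualSet hA.2 ht
  obtain ⟨r, hr, c, hc, hrc⟩ := h.exists_strongDomBy_dual hA.2 ha
  have hdom := (h.strongDomBy_mul (h.strongDomBy_mul hqQ hrc) hpP).dom
  refine ⟨q * (r * c * r) * p, ?_, Q * r * P, by rwa [mul_assoc s]⟩
  have := hA.mul_mul_mem (hA.mul_mul_mem hq hr hc) hr hp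
  simpa only [mul_assoc] using this

lemma IsAtlas.dualSet_subset_upClo (h : Structured N Z) (hA : IsAtlas N Z A) :
    dualSet N Z A ⊆ upClo N Z (dualSet N Z A) := by
  rintro s ⟨a, ha, b, hab⟩
  have hs : s ∈ dualSet N Z A := ⟨a, ha, b, hab⟩
  exact ⟨s * a * s, hA.dualSet_mul_mul_mem h hs ha hs, b, Structured.domBy_dual hab⟩

lemma IsAtlas.isCoset_dualSet (h : Structured N Z) (hA : IsAtlas N Z A) :
    IsCoset N Z (dualSet N Z A) := by
  refine ⟨?_, Set.Subset.antisymm ?_ ?_⟩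
  · rintro _ ⟨_, ⟨s, hs, x, hx, rfl⟩, t, ht, rfl⟩
    obtain ⟨p, hp, P, hpP⟩ := h.exists_strongDomBy_of_mem_dualSet hA.2 hs
    obtain ⟨q, hq, Q, hqQ⟩ := h.exists_strongDomBy_of_mem_dualSet hA.2 ht
    obtain ⟨r, hr, R, hrR⟩ :=
      h.exists_strongDomBy_of_mem_dualSet (hA.dualSet_subset_upClo h) hx
    have hdom := (h.strongDomBy_mul (h.strongDomBy_mul hqQ hrR) hpP).dom
    exact ⟨q * r * p, hA.mul_mul_mem hq hr hp, Q * R * P, by rwa [← mul_assoc] at hdom⟩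
  · rintro t ⟨s, ⟨a, ha, b, hab⟩, u, hu⟩
    have hsus : s * u * s ∈ dualSet N Z A := by
      refine ⟨a, ha, b * t * b, ?_⟩
      obtain ⟨a1, a2, a3, a4, a5, a6⟩ := hab
      obtain ⟨b1, b2, b3, b4, b5, b6⟩ := hu
      have e1 := h.zComm _ a6 _ b3
      have e2 := h.zComm _ a5 _ b4
      have e3 : b * t * b * (s * u * s) = (b * s) * (b * s) := by
        calc b * t * b * (s * u * s) = b * t * (b * s * (u * s)) := by simp only [mul_assoc]
          _ = b * (t * u * s) * (b * s) := by rw [e2]; simp only [mul_assoc]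
          _ = _ := by rw [b2]
      have e4 : s * u * s * (b * t * b) = (s * b) * (s * b) := by
        calc s * u * s * (b * t * b) = (s * u * (s * b)) * t * b := by simp only [mul_assoc]
          _ = s * b * (s * u * t) * b := by rw [← e1]; simp only [mul_assoc]
          _ = _ := by rw [b1]; simp only [mul_assoc]
      refine ⟨?_, ?_, ?_, ?_, ?_, ?_⟩
      · rw [mul_assoc, e4, ← mul_assoc, ← mul_assoc a, a1, ← mul_assoc, a1]
      · rw [e3, mul_assoc, a2, a2]
      · have := h.nMul _ a3 _ b4
        simpa only [mul_assoc] using this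
      · have := h.nMul _ b3 _ a4
        simpa only [mul_assoc] using this
      · exact e3 ▸ h.zMul _ a5 _ a5
      · exact e4 ▸ h.zMul _ a6 _ a6
    refine ⟨a * (s * u * s) * a, hA.mul_mul_mem ha hsus ha, u, ?_⟩
    obtain ⟨a1, a2, a3, a4, a5, a6⟩ := hab
    obtain ⟨b1, b2, b3, b4, b5, b6⟩ := hu
    have e1 := h.zComm _ b5 _ a4
    have e2 := h.zComm _ b6 _ a3
    have n1 := h.trinormal t u (s * a) a4 (by grind) (by grind) b5 b6
    have n2 := h.trinormal u t (a * s) a3 (by grind) (by grind) b6 b5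
    refine ⟨by grind, by grind, ?_, ?_, b6, b5⟩
    · have := h.nMul _ a3 _ n1
      simpa only [mul_assoc] using this
    · have := h.nMul _ n2 _ a4
      simpa only [mul_assoc] using this
  · exact hA.dualSet_subset_upClo h

lemma mul_subset_upClo (h : Structured N Z) (hA : A ⊆ upClo N Z A) (hB : B ⊆ upClo N Z B) :
    A * B ⊆ upClo N Z (A * B) := by
  rintro _ ⟨a, ha, b, hb, rfl⟩
  obtain ⟨a', ha', s, hs⟩ := h.exists_strongDomBy hA ha
  obtain ⟨b', hb', t, ht⟩ := h.exists_strongDomBy hB hb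
  exact ⟨a' * b', Set.mul_mem_mul ha' hb', t * s, (h.strongDomBy_mul hs ht).dom⟩

lemma dualSet_mul_mul_mem_dualSet (h : Structured N Z) (hA : IsAtlas N Z A)
    (hB : IsAtlas N Z B) (hAB : dualSet N Z A * A ⊆ upClo N Z (B * dualSet N Z B))
    {s a : S} (hs : s ∈ dualSet N Z (A * B)) (ha : a ∈ A) : s * a ∈ dualSet N Z B := by
  obtain ⟨_, ⟨a₁, ha₁, b₁, hb₁, rfl⟩, c, hc⟩ :=
    h.exists_strongDomBy_of_mem_dualSet (mul_subset_upClo h hA.2 hB.2) hs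
  obtain ⟨r, hr, a₀, ha₀, hra⟩ := h.exists_strongDomBy_dual hA.2 ha
  obtain ⟨_, ⟨b₂, hb₂, t₂, ht₂, rfl⟩, u, hu⟩ :=
    hAB (Set.mul_mem_mul hr (hA.mul_mul_mem ha₀ hr ha₁))
  obtain ⟨b₃, hb₃, v, hv⟩ := h.exists_strongDomBy hB.2 hb₁
  obtain ⟨_, ⟨b₄, hb₄, t₄, ht₄, rfl⟩, w, hw⟩ :=
    mul_subset_upClo h hB.2 (hB.dualSet_subset_upClo h) (Set.mul_mem_mul hb₂ ht₂)
  refine ⟨b₄ * t₄ * b₃, hB.mul_mul_mem hb₄ ht₄ hb₃, r * c, ?_⟩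
  refine h.domBy_trans (h.strongDomBy_mul (h.strongDomBy_trans hw hu) hv).dom ?_
  have := (h.strongDomBy_mul hra hc).dom
  simpa only [mul_assoc] using this

lemma mem_dualSet_singleton_mul (h : Structured N Z) (hA : IsAtlas N Z A)
    (hB : IsAtlas N Z B) (hAB : dualSet N Z A * A ⊆ upClo N Z (B * dualSet N Z B))
    {s a : S} (hs : s ∈ dualSet N Z (A * B)) (ha : a ∈ A) : s ∈ dualSet N Z ({a} * B) := by
  obtain ⟨_, ⟨a₁, ha₁, b₁, hb₁, rfl⟩, c, hc⟩ := hs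
  obtain ⟨a₀, ha₀, r, hr⟩ := hA.2 ha
  obtain ⟨a₂, ha₂, q, hq⟩ := h.exists_strongDomBy hA.2 ha₁
  obtain ⟨b₂, hb₂, v, hv⟩ := h.exists_strongDomBy hB.2 hb₁
  obtain ⟨_, ⟨b, hb, t, ht, rfl⟩, u, hu⟩ := hAB (Set.mul_mem_mul ⟨a₀, ha₀, a, hr⟩ ha₂)
  refine ⟨a * (b * t * b₂), Set.mul_mem_mul rfl (hB.mul_mul_mem hb ht hb₂), c, ?_⟩
  have := h.domBy_smul (h.domBy_mul_mul hq hv hu.2.2.2.1 hc) hr.2.2.2.2.1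
  have e : a * (b * t * b₂) = a * r * (a₂ * (u * (b * t)) * b₂) := by
    calc a * (b * t * b₂) = a * ((r * a₂ * u * (b * t)) * b₂) := by rw [hu.2.1]
      _ = _ := by simp only [mul_assoc]
  rwa [e]

lemma actsL_of_dualSet_mul_subset (hA : IsAtlas N Z A) (hB : IsAtlas N Z B)
    (hAB : dualSet N Z A * A ⊆ upClo N Z (B * dualSet N Z B)) {a : S} (ha : a ∈ A) :
    actsL Z a B := by
  obtain ⟨a₀, ha₀, r, hr⟩ := hA.2 ha
  obtain ⟨_, ⟨b, hb, t, ht, rfl⟩, u, hu⟩ :=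
    hAB (Set.mul_mem_mul ⟨a₀, ha₀, a, hr⟩ ha₀)
  refine ⟨r, hr.2.2.2.2.1, hr.2.2.2.2.2, b * t * b, hB.mul_mul_mem hb ht hb, ?_⟩
  have e : r * a * (b * t) = b * t := by
    calc r * a * (b * t) = r * a * (r * a₀ * u * (b * t)) := by rw [hu.2.1]
      _ = r * (a * r * a₀) * u * (b * t) := by simp only [mul_assoc]
      _ = b * t := by rw [hr.2.1, hu.2.1]
  rw [← mul_assoc, e]

lemma IsAtlas.mul (h : Structured N Z) (hA : IsAtlas N Z A) (hB : IsAtlas N Z B)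
    (hAB : dualSet N Z A * A ⊆ upClo N Z (B * dualSet N Z B)) : IsAtlas N Z (A * B) := by
  refine ⟨?_, mul_subset_upClo h hA.2 hB.2⟩
  rintro _ ⟨_, ⟨_, ⟨a, ha, b, hb, rfl⟩, s, hs, rfl⟩, _, ⟨a', ha', b', hb', rfl⟩, rfl⟩
  refine ⟨a, ha, b * (s * a') * b',
    hB.mul_mul_mem hb (dualSet_mul_mul_mem_dualSet h hA hB hAB hs ha') hb', ?_⟩
  simp only [mul_assoc]

end Domination

theorem stmt12 [Semigroup S] (N Z : Set S) (h : Structured N Z) (A B : Set S)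
    (hA : IsAtlas N Z A) (hB : IsAtlas N Z B)
    (hAB : dualSet N Z A * A ⊆ upClo N Z (B * dualSet N Z B)) :
    IsAtlas N Z (A * B) ∧
    IsCoset N Z (dualSet N Z (A * B)) ∧
    ∀ a ∈ A, actsL Z a B ∧ dualSet N Z ({a} * B) = dualSet N Z (A * B) := by
  have hmul := hA.mul h hB hAB
  refine ⟨hmul, hmul.isCoset_dualSet h, fun a ha => ⟨actsL_of_dualSet_mul_subset hA hB hAB ha, ?_⟩⟩
  refine Set.Subset.antisymm ?_ fun s hs => mem_dualSet_singleton_mul h hA hB hAB hs ha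
  rintro s ⟨x, hx, c, hc⟩
  exact ⟨x, Set.mul_subset_mul_right (Set.singleton_subset_iff.2 ha) hx, c, hc⟩
end

section
/- In a structured semigroup (S, N, Z), if A ⊆ S is an atlas and A|b holds for some b ∈ S, then Ab = A{b} is an atlas and r(Ab) = r(A). -/
open Pointwise

variable {S : Type*}

/-- Elements below `b`, in the weak sense of domination without the conditions involving `Z`,
inherit the dominations of `b`. -/
lemma domBy_of_factor [Semigroup S] {N Z : Set S} (h : Structured N Z) {a s b t c : S}
    (h₁ : a * s * b = a) (h₂ : b * s * a = a) (h₃ : a * s ∈ N) (h₄ : s * a ∈ N)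
    (hb : domBy N Z b t c) : domBy N Z a t c := by
  obtain ⟨k₁, k₂, k₃, k₄, k₅, k₆⟩ := hb
  have h₂' : c * t * a = a := calc
    c * t * a = c * t * (b * s * a) := by rw [h₂]
    _ = c * t * b * s * a := by simp only [mul_assoc]
    _ = a := by rw [k₂, h₂]
  refine ⟨by grind, h₂', ?_, ?_, k₅, k₆⟩
  · have := h.nMul _ h₃ _ k₃
    grind
  · have := h.nMul _ k₄ _ h₄
    grind

lemma domBy.trans [Semigroup S] {N Z : Set S} (h : Structured N Z) {a s b t c : S}
    (ha : domBy N Z a s b) (hb : domBy N Z b t c) : domBy N Z a t c :=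
  domBy_of_factor h ha.1 ha.2.1 ha.2.2.1 ha.2.2.2.1 hb

lemma domBy.mul_right_central [Semigroup S] {N Z : Set S} (h : Structured N Z) {a s b z : S}
    (ha : domBy N Z a s b) (hz : z ∈ Z) : domBy N Z (a * z) s b := by
  obtain ⟨h₁, h₂, h₃, h₄, h₅, h₆⟩ := ha
  have hc := h.zComm _ hz _ (h.zSubN h₆)
  refine ⟨by grind, by grind, ?_, ?_, h₅, h₆⟩
  · have := h.nMul _ h₃ _ (h.zSubN (h.binormal b s h₅ h₆ z hz).1)
    grind
  · have := h.nMul _ h₄ _ (h.zSubN hz)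
    grind

/-- If `A|b` then every domination of an element of `A` can be refined to one of an element
of `A` fixed by `bb'`. -/
lemma IsAtlas.exists_domBy_fixed [Semigroup S] {N Z : Set S} (h : Structured N Z) {A : Set S}
    (hA : IsAtlas N Z A) {a₀ e : S} (ha₀ : a₀ ∈ A) (he : a₀ * e = a₀) {a s d : S} (ha : a ∈ A)
    (hs : domBy N Z a s d) : ∃ c ∈ A, c * e = c ∧ domBy N Z c s d := by
  obtain ⟨a₁, ha₁, t, ht⟩ := hA.2 ha₀
  refine ⟨a * t * a₀, hA.1 (Set.mul_mem_mul (Set.mul_mem_mul ha ⟨a₁, ha₁, a₀, ht⟩) ha₀),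
    by grind, ?_⟩
  rw [mul_assoc]
  exact hs.mul_right_central h ht.2.2.2.2.2

lemma domBy.mul_right [Semigroup S] {N Z : Set S} (h : Structured N Z) {c s a b b' : S}
    (hs : domBy N Z c s a) (hb : b * b' ∈ Z) (hb' : b' * b ∈ Z) (hc : c * b * b' = c) :
    domBy N Z (c * b) (b' * s) (a * b) := by
  obtain ⟨h₁, h₂, h₃, h₄, h₅, h₆⟩ := hs
  have hcomm := h.zComm _ hb _ h₄
  refine ⟨by grind, by grind, by grind, ?_, ?_, ?_⟩
  · have := h.trinormal b b' (s * c) h₄ (by grind) (by grind) hb hb'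
    grind
  · have := (h.binormal a s h₅ h₆ _ hb).1
    grind
  · have := (h.binormal b b' hb hb' _ h₆).2
    grind

lemma domBy.of_mul_right [Semigroup S] {N Z : Set S} (h : Structured N Z) {c s d b b' : S}
    (hs : domBy N Z (c * b) s d) (hb : b * b' ∈ Z) (hb' : b' * b ∈ Z) (hc : c * b * b' = c) :
    domBy N Z c (b * s) (d * b') := by
  obtain ⟨h₁, h₂, h₃, h₄, h₅, h₆⟩ := hs
  have hcomm := h.zComm _ hb' _ h₄
  have h₂' : d * b' * (b * s) * c = c := calc
    d * b' * (b * s) * c = d * b' * (b * s) * (c * b * b') := by rw [hc]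
    _ = d * (b' * b * (s * (c * b))) * b' := by simp only [mul_assoc]
    _ = d * s * (c * b) * b' * b * b' := by rw [hcomm]; simp only [mul_assoc]
    _ = c := by rw [h₂, hc, hc]
  refine ⟨by grind, h₂', by grind, ?_, ?_, ?_⟩
  · have := h.trinormal b' b (s * (c * b)) h₄ (by grind) (by grind) hb' hb
    grind
  · have := (h.binormal d s h₅ h₆ _ hb').1
    grind
  · have := (h.binormal b b' hb hb' _ h₆).1
    grind

/-- If `a'` is dominated by `a` via `t` and `c` by `d` via `s`, then `a'scs` inherits the
dominations of `as`. -/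
lemma domBy.of_mul_dual [Semigroup S] {N Z : Set S} (h : Structured N Z) {a' t a c s d u x : S}
    (ht : domBy N Z a' t a) (hs : domBy N Z c s d) (hx : domBy N Z (a * s) u x) :
    domBy N Z (a' * s * c * s) u x := by
  obtain ⟨h₁, h₂, h₃, h₄, h₅, h₆⟩ := ht
  obtain ⟨k₁, k₂, k₃, k₄, k₅, k₆⟩ := hs
  have hn : t * a' * (s * c) ∈ N := h.nMul _ h₄ _ k₄
  have e₁ := h.zComm _ h₆ _ k₄
  have e₂ := h.zComm _ k₆ _ h₄
  have e₃ := h.zComm _ h₆ _ hn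
  have e₄ := h.zComm _ k₆ _ hn
  have f₃ : t * a * (t * a' * (s * c)) = t * a' * (s * c) := calc
    _ = t * (a * t * a') * (s * c) := by simp only [mul_assoc]
    _ = _ := by rw [h₂]
  have f₄ : t * a' * (s * c) * (s * d) = t * a' * (s * c) := calc
    _ = t * a' * (s * (c * s * d)) := by simp only [mul_assoc]
    _ = _ := by rw [k₁]
  refine domBy_of_factor (s := d * t) h ?_ ?_ ?_ ?_ hx
  · calc
      _ = a' * (s * (c * s * d) * (t * a)) * s := by simp only [mul_assoc]
      _ = a' * t * a * (s * c * s) := by rw [k₁, ← e₁]; simp only [mul_assoc]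
      _ = _ := by rw [h₁]; simp only [mul_assoc]
  · calc
      _ = a * (s * d * (t * a')) * (s * c * s) := by simp only [mul_assoc]
      _ = a * t * a' * (s * (d * s * c) * s) := by rw [e₂]; simp only [mul_assoc]
      _ = _ := by rw [h₂, k₂]; simp only [mul_assoc]
  · have := h.trinormal t a _ hn f₃ (by rw [mul_assoc, ← e₃, f₃]) h₆ h₅
    have e : a' * s * c * s * (d * t) = a * (t * a' * (s * c)) * t := calc
      _ = a' * s * (c * s * d) * t := by simp only [mul_assoc]
      _ = a * t * a' * s * c * t := by rw [k₁, h₂]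
      _ = _ := by simp only [mul_assoc]
    rwa [e]
  · have := h.trinormal s d _ hn (by rw [e₄, f₄]) (by rw [mul_assoc, f₄]) k₆ k₅
    simpa only [mul_assoc] using this

theorem stmt13 [Semigroup S] (N Z : Set S) (h : Structured N Z) (A : Set S)
    (hA : IsAtlas N Z A) (b : S) (hb : actsR Z A b) :
    IsAtlas N Z (A * {b}) ∧ rngSet N Z (A * {b}) = rngSet N Z A := by
  obtain ⟨b', hb, hb', a₀, ha₀, he⟩ := hb
  rw [mul_assoc] at he
  have fixed {a s d : S} (ha : a ∈ A) (hs : domBy N Z a s d) :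
      ∃ c ∈ A, c * b * b' = c ∧ domBy N Z c s d := by
    simpa only [mul_assoc] using hA.exists_domBy_fixed h ha₀ he ha hs
  have right {a : S} (ha : a ∈ A) : a * b ∈ A * {b} := Set.mul_mem_mul ha rfl
  have left {x : S} (hx : x ∈ A * {b}) : ∃ a ∈ A, a * b = x := by
    simpa only [Set.mul_singleton, Set.mem_image] using hx
  have up : A * {b} ⊆ upClo N Z (A * {b}) := by
    intro x hx
    obtain ⟨a, ha, rfl⟩ := left hx
    obtain ⟨a', ha', s, hs⟩ := hA.2 ha
    obtain ⟨c, hc, hcb, hcs⟩ := fixed ha' hs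
    exact ⟨c * b, right hc, _, hcs.mul_right h hb hb' hcb⟩
  have dual {s : S} (hs : s ∈ dualSet N Z (A * {b})) : b * s ∈ dualSet N Z A := by
    obtain ⟨x, hx, d, hd⟩ := hs
    obtain ⟨a, ha, rfl⟩ := left hx
    obtain ⟨a', ha', t, ht⟩ := hA.2 ha
    obtain ⟨c, hc, hcb, hct⟩ := fixed ha' ht
    exact ⟨c, hc, _, ((hct.mul_right h hb hb' hcb).trans h hd).of_mul_right h hb hb' hcb⟩
  refine ⟨⟨?_, up⟩, ?_⟩
  · rintro _ ⟨_, ⟨x, hx, s, hs, rfl⟩, y, hy, rfl⟩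
    obtain ⟨a, ha, rfl⟩ := left hx
    obtain ⟨c, hc, rfl⟩ := left hy
    have := right (hA.1 (Set.mul_mem_mul (Set.mul_mem_mul ha (dual hs)) hc))
    simpa only [mul_assoc] using this
  · ext x
    constructor
    · rintro ⟨_, ⟨y, hy, s, hs, rfl⟩, hx⟩
      obtain ⟨a, ha, rfl⟩ := left hy
      refine ⟨a * (b * s), Set.mul_mem_mul ha (dual hs), ?_⟩
      simpa only [mul_assoc] using hx
    · rintro ⟨_, ⟨a, ha, s, ⟨c₀, hc₀, d, hd⟩, rfl⟩, u, hx⟩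
      obtain ⟨a', ha', t, ht⟩ := hA.2 ha
      obtain ⟨c, hc, hcb, hcs⟩ := fixed hc₀ hd
      have hmem : a' * s * c ∈ A :=
        hA.1 (Set.mul_mem_mul (Set.mul_mem_mul ha' ⟨c, hc, d, hcs⟩) hc)
      have hq : a' * s * c * b * (b' * s) = a' * s * c * s := by grind
      exact ⟨a' * s * c * b * (b' * s), Set.mul_mem_mul (right hmem)
        ⟨c * b, right hc, _, hcs.mul_right h hb hb' hcb⟩, u, hq ▸ ht.of_mul_dual h hcs hx⟩
end
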